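/- arXiv:2404.08182 — 2 statements merged into one kernel-verified Lean document; each statement's English description precedes it below -/
import Mathlib

section
/- Let H be a countable abelian group and let Γ be a countable i.c.c. group acting on H by group automorphisms α : Γ → Aut(H). Suppose that the induced action of Γ on the Pontryagin dual Ĥ (equipped with its normalized Haar probability measure) is measurably conjugate to the Bernoulli action Γ ↷ ([0,1]^Γ, λ^Γ); that is, there exists a measure-preserving measurable isomorphism θ : Ĥ → [0,1]^Γ (invertible off a null set) such that for every g ∈ Γ, θ(g·x) = g·θ(x) for almost every x ∈ Ĥ. Then every nontrivial normal abelian subgroup K of the semidirect product H ⋊_α Γ is contained in the canonical copy of H. -/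
open MeasureTheory
open scoped unitInterval

/-- `μ` is the product measure `λ^ι` of Lebesgue measure on `[0,1]` over the index set `ι`:
it is the (unique) probability measure on `ι → [0,1]` assigning to each measurable cylinder
the product of the Lebesgue measures of its sides. -/
def IsProductLebesgue (ι : Type*) (μ : Measure (ι → I)) : Prop :=
  IsProbabilityMeasure μ ∧
    ∀ (s : Finset ι) (A : ι → Set I), (∀ i ∈ s, MeasurableSet (A i)) →
      μ {ω | ∀ i ∈ s, ω i ∈ A i} = ∏ i ∈ s, volume (A i)

/-- The dual action of `Γ` on the Pontryagin dual `Ĥ` induced by an action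
`α : Γ →* Aut(H)` on a discrete abelian group `H`: `(g · χ)(h) = χ (α g⁻¹ h)`. -/
noncomputable def dualAct {H : Type*} [CommGroup H] [TopologicalSpace H] [DiscreteTopology H]
    {Γ : Type*} [Group Γ] (α : Γ →* MulAut H) (g : Γ) (χ : PontryaginDual H) :
    PontryaginDual H :=
  ContinuousMonoidHom.comp χ
    ⟨((α g⁻¹ : H ≃* H) : H →* H), continuous_of_discreteTopology⟩

open Filter Topology

/-- Product formula for two cylinders with disjoint supports. -/
lemma cyl_indep {ι : Type*} {μ : Measure (ι → I)} (hμ : IsProductLebesgue ι μ)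
    (s t : Finset ι) (hst : Disjoint s t) (A B : ι → Set I)
    (hA : ∀ i, MeasurableSet (A i)) (hB : ∀ i, MeasurableSet (B i)) :
    μ ({ω | ∀ i ∈ s, ω i ∈ A i} ∩ {ω | ∀ i ∈ t, ω i ∈ B i}) =
      μ {ω | ∀ i ∈ s, ω i ∈ A i} * μ {ω | ∀ i ∈ t, ω i ∈ B i} := by
  classical
  rw [hμ.2 s A (fun i _ => hA i), hμ.2 t B (fun i _ => hB i)]
  have h := hμ.2 (s ∪ t) (fun i => if i ∈ s then A i else B i)
    (fun i _ => by split_ifs <;> simp [hA, hB])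
  have hne : ∀ i ∈ t, i ∉ s := fun i hi hs => Finset.disjoint_left.1 hst hs hi
  rw [Finset.prod_union hst] at h
  rw [Finset.prod_congr rfl (g := fun i => volume (A i)) (fun i hi => by simp [hi])] at h
  rw [Finset.prod_congr (s₁ := t) rfl (g := fun i => volume (B i))
    (fun i hi => by simp [hne i hi])] at h
  rw [← h]
  congr 1
  ext ω
  simp only [Set.mem_inter_iff, Set.mem_ofPred_eq, Finset.mem_union]
  constructor
  · rintro ⟨h1, h2⟩ i hi
    by_cases his : i ∈ s
    · simpa [his] using h1 i his
    · simpa [his] using h2 i (hi.resolve_left his)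
  · intro h
    refine ⟨fun i hi => ?_, fun i hi => ?_⟩
    · simpa [hi] using h i (Or.inl hi)
    · simpa [hne i hi] using h i (Or.inr hi)

/-- The family of measurable cylinders. -/
def cylFam (ι : Type*) : Set (Set (ι → I)) :=
  squareCylinders fun _ => {s : Set I | MeasurableSet s}

lemma cylFam_pi (ι : Type*) : IsPiSystem (cylFam ι) :=
  isPiSystem_squareCylinders (fun _ => MeasurableSpace.isPiSystem_measurableSet)
    (fun _ => by simp)

lemma cylFam_gen (ι : Type*) :
    (MeasurableSpace.pi : MeasurableSpace (ι → I)) = MeasurableSpace.generateFrom (cylFam ι) :=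
  generateFrom_squareCylinders.symm

lemma mem_cylFam {ι : Type*} {S : Set (ι → I)} (h : S ∈ cylFam ι) :
    ∃ (s : Finset ι) (A : ι → Set I), (∀ i, MeasurableSet (A i)) ∧
      S = {ω | ∀ i ∈ s, ω i ∈ A i} := by
  obtain ⟨s, A, hA, rfl⟩ := h
  refine ⟨s, A, fun i => hA i (Set.mem_univ i), ?_⟩
  ext ω
  simp [Set.mem_pi]

lemma shift_meas {Γ : Type*} [Group Γ] (g : Γ) :
    Measurable (fun (ω : Γ → I) (t : Γ) => ω (g⁻¹ * t)) :=
  measurable_pi_lambda _ fun t => measurable_pi_apply (g⁻¹ * t)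

lemma shift_cyl {Γ : Type*} [Group Γ] [DecidableEq Γ] (g : Γ) (s : Finset Γ) (B : Γ → Set I) :
    (fun (ω : Γ → I) (t : Γ) => ω (g⁻¹ * t)) ⁻¹' {ω | ∀ i ∈ s, ω i ∈ B i} =
      {ω | ∀ i ∈ s.image (fun i => g⁻¹ * i), ω i ∈ B (g * i)} := by
  ext ω
  simp only [Set.mem_preimage, Set.mem_ofPred_eq, Finset.forall_mem_image, mul_inv_cancel_left]

lemma hasSum_real_iUnion {X : Type*} [MeasurableSpace X] {μ : Measure X} [IsFiniteMeasure μ]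
    {f : ℕ → Set X} (hf : ∀ i, MeasurableSet (f i))
    (hd : Pairwise (Function.onFun Disjoint f)) :
    HasSum (fun k => μ.real (f k)) (μ.real (⋃ k, f k)) := by
  have h := measure_iUnion (μ := μ) hd hf
  simp only [Measure.real]
  rw [h, ENNReal.tsum_toReal_eq (fun _ => measure_ne_top _ _)]
  exact (ENNReal.summable_toReal (h ▸ measure_ne_top _ _)).hasSum

lemma mixing {Γ : Type*} [Group Γ] {μ : Measure (Γ → I)} (hμ : IsProductLebesgue Γ μ)
    (N : Set Γ) (B : Set (Γ → I)) (hB : B ∈ cylFam Γ) (C : Set (Γ → I)) (hC : MeasurableSet C) :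
    Tendsto (fun n : N => μ.real (C ∩ (fun (ω : Γ → I) (t : Γ) => ω ((n : Γ)⁻¹ * t)) ⁻¹' B))
      cofinite (𝓝 (μ.real C * μ.real B)) := by
  classical
  have := hμ.1
  obtain ⟨s, A, hA, rfl⟩ := mem_cylFam hB
  have hBm : MeasurableSet {ω : Γ → I | ∀ i ∈ s, ω i ∈ A i} := by
    rw [cylFam_gen]; exact MeasurableSpace.measurableSet_generateFrom hB
  have hshift : ∀ g : Γ, μ ((fun (ω : Γ → I) (t : Γ) => ω (g⁻¹ * t)) ⁻¹'
      {ω | ∀ i ∈ s, ω i ∈ A i}) = μ {ω | ∀ i ∈ s, ω i ∈ A i} := by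
    intro g
    rw [shift_cyl, hμ.2 _ _ (fun i _ => hA _), hμ.2 _ _ (fun i _ => hA _),
      Finset.prod_image (by intro a _ b _ h; simpa using h)]
    simp
  induction C, hC using MeasurableSpace.induction_on_inter (cylFam_gen Γ) (cylFam_pi Γ) with
  | empty => simpa using tendsto_const_nhds
  | basic C hC =>
    obtain ⟨u, D, hD, rfl⟩ := mem_cylFam hC
    apply tendsto_const_nhds.congr'
    have hfin : {n : N | ¬ Disjoint u (s.image (fun i => (n : Γ)⁻¹ * i))}.Finite := by
      have : (((s ×ˢ u).image (fun p => p.1 * p.2⁻¹) : Finset Γ) : Set Γ).Finite :=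
        Finset.finite_toSet _
      refine (this.preimage (f := ((↑) : N → Γ)) Subtype.val_injective.injOn).subset ?_
      intro n hn
      simp only [Set.mem_ofPred_eq, Finset.not_disjoint_iff, Finset.mem_image] at hn
      obtain ⟨a, ha, i, hi, rfl⟩ := hn
      simp only [Set.mem_preimage, Finset.coe_image, Set.mem_image, Finset.mem_coe,
        Finset.mem_product]
      exact ⟨(i, (n : Γ)⁻¹ * i), ⟨hi, ha⟩, by simp⟩
    filter_upwards [hfin.compl_mem_cofinite] with n hn
    have hn' : Disjoint u (s.image (fun i => (n : Γ)⁻¹ * i)) := by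
      by_contra h; exact hn h
    simp only [Measure.real]
    rw [← hshift n, shift_cyl, cyl_indep hμ u _ hn' D _ hD (fun i => hA _), ENNReal.toReal_mul]
  | compl C hC ih =>
    have h1 : ∀ n : N, μ.real (Cᶜ ∩ (fun (ω : Γ → I) (t : Γ) => ω ((n : Γ)⁻¹ * t)) ⁻¹'
        {ω | ∀ i ∈ s, ω i ∈ A i}) = μ.real {ω | ∀ i ∈ s, ω i ∈ A i} -
        μ.real (C ∩ (fun (ω : Γ → I) (t : Γ) => ω ((n : Γ)⁻¹ * t)) ⁻¹'
        {ω | ∀ i ∈ s, ω i ∈ A i}) := by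
      intro n
      have h2 := measureReal_inter_add_sdiff (μ := μ)
        (s := (fun (ω : Γ → I) (t : Γ) => ω ((n : Γ)⁻¹ * t)) ⁻¹' {ω | ∀ i ∈ s, ω i ∈ A i}) hC
      have h3 : μ.real ((fun (ω : Γ → I) (t : Γ) => ω ((n : Γ)⁻¹ * t)) ⁻¹'
        {ω | ∀ i ∈ s, ω i ∈ A i}) = μ.real {ω | ∀ i ∈ s, ω i ∈ A i} := by
        simp only [Measure.real, hshift]
      rw [Set.inter_comm Cᶜ, Set.inter_comm C, ← Set.sdiff_eq]
      linarith
    simp only [h1, probReal_compl_eq_one_sub hC]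
    have := (tendsto_const_nhds (x := μ.real {ω | ∀ i ∈ s, ω i ∈ A i})).sub ih
    convert this using 2
    ring
  | iUnion f hd hf ih =>
    have hs : HasSum (fun k => μ.real (f k)) (μ.real (⋃ k, f k)) :=
      hasSum_real_iUnion hf hd
    have h1 : ∀ n : N, μ.real ((⋃ k, f k) ∩ (fun (ω : Γ → I) (t : Γ) => ω ((n : Γ)⁻¹ * t)) ⁻¹'
        {ω | ∀ i ∈ s, ω i ∈ A i}) = ∑' k, μ.real (f k ∩ (fun (ω : Γ → I) (t : Γ) =>
          ω ((n : Γ)⁻¹ * t)) ⁻¹' {ω | ∀ i ∈ s, ω i ∈ A i}) := by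
      intro n
      rw [Set.iUnion_inter]
      refine (HasSum.tsum_eq (hasSum_real_iUnion
        (fun k => (hf k).inter (shift_meas _ hBm)) ?_)).symm
      intro i j hij
      exact (hd hij).mono Set.inter_subset_left Set.inter_subset_left
    simp only [h1]
    rw [← hs.tsum_eq, ← tsum_mul_right]
    refine tendsto_tsum_of_dominated_convergence hs.summable ih ?_
    refine Eventually.of_forall fun n k => ?_
    rw [Real.norm_of_nonneg measureReal_nonneg]
    exact measureReal_mono Set.inter_subset_left

lemma zero_one {Γ : Type*} [Group Γ] {μ : Measure (Γ → I)} (hμ : IsProductLebesgue Γ μ)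
    (N : Set Γ) (hN : N.Infinite) (A : Set (Γ → I)) (hA : MeasurableSet A)
    (h : ∀ n ∈ N, ∀ B, MeasurableSet B →
      μ (A ∩ (fun (ω : Γ → I) (t : Γ) => ω (n⁻¹ * t)) ⁻¹' B) = μ (A ∩ B)) :
    μ A = 0 ∨ μ Aᶜ = 0 := by
  have := hμ.1
  have : Infinite N := hN.to_subtype
  have hBm : ∀ B ∈ cylFam Γ, MeasurableSet B := fun B hB => by
    rw [cylFam_gen]; exact MeasurableSpace.measurableSet_generateFrom hB
  have key : μ.restrict A = μ A • μ := by
    refine ext_of_generate_finite (cylFam Γ) (cylFam_gen Γ) (cylFam_pi Γ) ?_ (by simp)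
    intro B hB
    have h1 := mixing hμ N B hB A hA
    have h2 : ∀ n : N, μ.real (A ∩ (fun (ω : Γ → I) (t : Γ) => ω ((n : Γ)⁻¹ * t)) ⁻¹' B) =
        μ.real (A ∩ B) := fun n => by
      simp only [Measure.real, h n n.2 B (hBm B hB)]
    simp only [h2] at h1
    have h3 := tendsto_nhds_unique h1 tendsto_const_nhds
    rw [Measure.restrict_apply (hBm B hB), Measure.smul_apply, smul_eq_mul, Set.inter_comm]
    simp only [Measure.real, ← ENNReal.toReal_mul] at h3
    exact ((ENNReal.toReal_eq_toReal_iff' (by finiteness) (by finiteness)).1 h3).symm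
  have h4 := congrArg (fun m => m Aᶜ) key
  simp only [Measure.restrict_apply hA.compl, Measure.smul_apply, smul_eq_mul,
    Set.compl_inter_self, measure_empty] at h4
  simpa using h4.symm

lemma dualAct_apply {H : Type*} [CommGroup H] [TopologicalSpace H] [DiscreteTopology H]
    {Γ : Type*} [Group Γ] (α : Γ →* MulAut H) (g : Γ) (χ : PontryaginDual H) (a : H) :
    dualAct α g χ a = χ (α g⁻¹ a) := rfl

lemma dualAct_mp {H : Type*} [CommGroup H] [TopologicalSpace H] [DiscreteTopology H]
    {Γ : Type*} [Group Γ] (α : Γ →* MulAut H)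
    [MeasurableSpace (PontryaginDual H)] [BorelSpace (PontryaginDual H)]
    (ν : Measure (PontryaginDual H)) [ν.IsHaarMeasure] (g : Γ) :
    MeasurePreserving (dualAct α g) ν ν := by
  let F := PontryaginDual.map (⟨((α g⁻¹ : H ≃* H) : H →* H), continuous_of_discreteTopology⟩ :
    H →ₜ* H)
  have hF : ∀ χ, F χ = dualAct α g χ := fun χ => rfl
  have := MonoidHom.measurePreserving (μ := ν) (ν := ν) (f := (F : PontryaginDual H →* _))
    F.continuous_toFun (fun χ => ⟨dualAct α g⁻¹ χ, ?_⟩) rfl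
  · exact this
  · change F (dualAct α g⁻¹ χ) = χ
    rw [hF]
    apply PontryaginDual.ext
    intro a
    simp [dualAct_apply]

/-- Let `H` be a countable abelian group and `Γ` a countable i.c.c. group
acting on `H` by automorphisms `α : Γ → Aut H`. Suppose the induced dual action of `Γ` on the
Pontryagin dual `Ĥ` (with its normalized Haar probability measure `ν`) is measurably
conjugate to the Bernoulli action `Γ ↷ ([0,1]^Γ, λ^Γ)`, i.e. there is a measure-preserving
measurable map `θ : Ĥ → [0,1]^Γ`, invertible off a null set, intertwining the two actions
almost everywhere. Then every nontrivial normal abelian subgroup `K` of `H ⋊[α] Γ` is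
contained in the canonical copy of `H`. -/
theorem normal_abelian_subgroup_le_base
    {H : Type*} [CommGroup H] [Countable H] [TopologicalSpace H] [DiscreteTopology H]
    {Γ : Type*} [Group Γ] [Countable Γ]
    (hicc : ∀ g : Γ, g ≠ 1 → {x : Γ | ∃ t : Γ, x = t * g * t⁻¹}.Infinite)
    (α : Γ →* MulAut H)
    [MeasurableSpace (PontryaginDual H)] [BorelSpace (PontryaginDual H)]
    (ν : Measure (PontryaginDual H)) [ν.IsHaarMeasure] [IsProbabilityMeasure ν]
    (μ : Measure (Γ → I)) (hμ : IsProductLebesgue Γ μ)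
    (θ : PontryaginDual H → (Γ → I)) (ψ : (Γ → I) → PontryaginDual H)
    (hθ : MeasurePreserving θ ν μ) (hψ : MeasurePreserving ψ μ ν)
    (hψθ : ∀ᵐ x ∂ν, ψ (θ x) = x) (hθψ : ∀ᵐ ω ∂μ, θ (ψ ω) = ω)
    (hequiv : ∀ g : Γ, ∀ᵐ x ∂ν, θ (dualAct α g x) = fun t => θ x (g⁻¹ * t))
    (K : Subgroup (H ⋊[α] Γ)) (hKnormal : K.Normal)
    (hKab : ∀ a ∈ K, ∀ b ∈ K, a * b = b * a) (hKne : K ≠ ⊥) :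
    K ≤ (SemidirectProduct.inl : H →* H ⋊[α] Γ).range := by
  classical
  have := hμ.1
  intro k hk
  by_contra hkH
  obtain ⟨h, g⟩ := k
  have hg : g ≠ 1 := by
    rintro rfl
    exact hkH ⟨h, rfl⟩
  -- `c a` lies in `K ∩ H`
  have hc : ∀ a : H, (SemidirectProduct.inl (a * (α g a)⁻¹) : H ⋊[α] Γ) ∈ K := by
    intro a
    have h1 := K.mul_mem (hKnormal.conj_mem _ hk (SemidirectProduct.inl a)) (K.inv_mem hk)
    convert h1 using 1
    ext
    · simp only [SemidirectProduct.mul_left, SemidirectProduct.mul_right,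
        SemidirectProduct.left_inl, SemidirectProduct.right_inl, SemidirectProduct.inv_left,
        SemidirectProduct.inv_right, map_one, MulAut.one_apply, map_inv, one_mul, inv_one,
        mul_one, MulAut.apply_inv_self]
      rw [mul_comm a h, mul_assoc h, mul_comm h, mul_inv_cancel_right]
    · simp
  -- conjugates of `g` act trivially on `K ∩ H`
  have hfix : ∀ n ∈ {x : Γ | ∃ t : Γ, x = t * g * t⁻¹}, ∀ c : H,
      (SemidirectProduct.inl c : H ⋊[α] Γ) ∈ K → α n c = c := by
    rintro n ⟨t, rfl⟩ c hcK
    have h1 := hKab _ (hKnormal.conj_mem _ hk (SemidirectProduct.inr t)) _ hcK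
    have h2 := congrArg SemidirectProduct.left h1
    simp only [SemidirectProduct.mul_left, SemidirectProduct.mul_right,
      SemidirectProduct.left_inl, SemidirectProduct.right_inl, SemidirectProduct.left_inr,
      SemidirectProduct.right_inr, SemidirectProduct.inv_left, SemidirectProduct.inv_right,
      map_one, MulAut.one_apply] at h2
    rw [mul_comm c] at h2
    exact mul_left_cancel h2
  -- hence every character kills `c a`
  have hkill : ∀ c : H, (SemidirectProduct.inl c : H ⋊[α] Γ) ∈ K →
      ∀ χ : PontryaginDual H, χ c = 1 := by
    intro c hcK χ
    by_contra hχ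
    have hcont : Continuous (fun χ : PontryaginDual H => χ c) :=
      (continuous_eval_const (F := C(H, Circle)) c).comp
        (ContinuousMonoidHom.isInducing_toContinuousMap H Circle).continuous
    obtain ⟨U, V, hU, hV, hUc, hV1, hUV⟩ := t2_separation hχ
    set E := (fun χ : PontryaginDual H => χ c) ⁻¹' U with hE
    have hEo : IsOpen E := hU.preimage hcont
    have hVo : IsOpen ((fun χ : PontryaginDual H => χ c) ⁻¹' V) := hV.preimage hcont
    have hE1 : ν E ≠ 0 := (hEo.measure_pos ν ⟨χ, hUc⟩).ne'
    have hE2 : ν Eᶜ ≠ 0 := by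
      refine (lt_of_lt_of_le (hVo.measure_pos ν ⟨1, hV1⟩) (measure_mono ?_)).ne'
      intro χ' h1 h2
      exact Set.disjoint_left.1 hUV h2 h1
    have hEm := hEo.measurableSet
    have htrans : ∀ B, MeasurableSet B → μ (ψ ⁻¹' E ∩ B) = ν (E ∩ θ ⁻¹' B) := by
      intro B hB
      rw [← hθ.measure_preimage ((hψ.measurable hEm).inter hB).nullMeasurableSet]
      apply measure_congr
      filter_upwards [hψθ] with x hx
      apply propext
      change (ψ (θ x) ∈ E ∧ θ x ∈ B) ↔ (x ∈ E ∧ θ x ∈ B)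
      rw [hx]
    have h01 := zero_one hμ _ (hicc g hg) (ψ ⁻¹' E) (hψ.measurable hEm) (by
      intro n hn B hB
      rw [htrans _ (shift_meas n hB), htrans _ hB,
        ← (dualAct_mp α ν n).measure_preimage
          (hEm.inter (hθ.measurable hB)).nullMeasurableSet]
      apply measure_congr
      filter_upwards [hequiv n] with x hx
      apply propext
      change (x ∈ E ∧ (fun t => θ x (n⁻¹ * t)) ∈ B) ↔ (dualAct α n x ∈ E ∧ θ (dualAct α n x) ∈ B)
      rw [hx]
      have : dualAct α n x c = x c := by
        rw [dualAct_apply]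
        congr 1
        rw [map_inv, MulAut.inv_apply, MulEquiv.symm_apply_eq]
        exact (hfix n hn c hcK).symm
      have h2 : dualAct α n x ∈ E ↔ x ∈ E := by
        change dualAct α n x c ∈ U ↔ x c ∈ U
        rw [this]
      rw [h2])
    rw [← Set.preimage_compl, hψ.measure_preimage hEm.nullMeasurableSet,
      hψ.measure_preimage hEm.compl.nullMeasurableSet] at h01
    exact h01.elim hE1 hE2
  -- so `g` acts trivially on the dual
  have htriv : ∀ χ : PontryaginDual H, dualAct α g χ = χ := by
    intro χ
    apply PontryaginDual.ext
    intro a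
    have h1 := hkill _ (hc (α g⁻¹ a)) χ
    rw [map_mul, map_inv χ] at h1
    rw [dualAct_apply, mul_inv_eq_one.1 h1]
    congr 1
    simp
  -- contradiction with faithfulness of the Bernoulli action
  let half : I := ⟨1 / 2, by norm_num, by norm_num⟩
  have h1 := cyl_indep hμ {1} {g⁻¹} (by simpa using hg)
    (fun _ => Set.Iio half) (fun _ => Set.Ioi half)
    (fun _ => measurableSet_Iio) (fun _ => measurableSet_Ioi)
  rw [hμ.2 _ _ (fun i _ => measurableSet_Iio), hμ.2 _ _ (fun i _ => measurableSet_Ioi),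
    Finset.prod_singleton, Finset.prod_singleton, unitInterval.volume_Iio,
    unitInterval.volume_Ioi] at h1
  have h2 : μ ({ω : Γ → I | ∀ i ∈ ({1} : Finset Γ), ω i ∈ Set.Iio half} ∩
      {ω | ∀ i ∈ ({g⁻¹} : Finset Γ), ω i ∈ Set.Ioi half}) = 0 := by
    have hae : ∀ᵐ x ∂ν, ¬ (θ x 1 < half ∧ half < θ x g⁻¹) := by
      filter_upwards [hequiv g] with x hx
      rw [htriv] at hx
      have h3 := congrFun hx 1
      rw [mul_one] at h3
      rw [h3]
      exact fun h => lt_asymm h.1 h.2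
    have hset : ({ω : Γ → I | ∀ i ∈ ({1} : Finset Γ), ω i ∈ Set.Iio half} ∩
      {ω | ∀ i ∈ ({g⁻¹} : Finset Γ), ω i ∈ Set.Ioi half}) =
        {ω | ω 1 < half} ∩ {ω | half < ω g⁻¹} := by
      ext ω; simp
    rw [hset, ← hθ.measure_preimage]
    · rw [ae_iff] at hae
      convert hae using 2
      ext x
      simp
    · exact ((measurableSet_lt (measurable_pi_apply _) measurable_const).inter
        (measurableSet_lt measurable_const (measurable_pi_apply _))).nullMeasurableSet
  rw [h2] at h1
  have h5 : (half : ℝ) = 1 / 2 := rfl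
  rw [h5, eq_comm, mul_eq_zero, ENNReal.ofReal_eq_zero, ENNReal.ofReal_eq_zero] at h1
  norm_num at h1
end

section
/- Let Γ be a group, Λ ≤ Γ a subgroup, and 𝒢 = {Σ₁, …, Σₙ} a finite family of subgroups of Γ, each of which is normal in Γ. Then Λ is almost malnormal relative to 𝒢 (i.e., for every s ∈ Γ ∖ Λ the set sΛs⁻¹ ∩ Λ is small relative to 𝒢) if and only if for all s, t ∈ Γ with at least one of s, t not in Λ, the set sΛt ∩ Λ is small relative to 𝒢. -/
/-- A subset `S` of a group `Γ` is *small relative to* a finite family of subgroups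
`Sigmas : Fin n → Subgroup Γ` if it is contained in a finite union of sets of the form
`s_j • Σ_{i_j} • t_j`. -/
def SmallRel {Γ : Type*} [Group Γ] {n : ℕ} (Sigmas : Fin n → Subgroup Γ) (S : Set Γ) : Prop :=
  ∃ (m : ℕ) (a b : Fin m → Γ) (idx : Fin m → Fin n),
    S ⊆ ⋃ j : Fin m, (fun x => a j * x * b j) '' (Sigmas (idx j) : Set Γ)

/-- Let `Γ` be a group, `Λ ≤ Γ` a subgroup, and `𝒢 = {Σ₁, …, Σₙ}` a finite
family of subgroups of `Γ`, each normal in `Γ`. Then `Λ` is almost malnormal relative to `𝒢`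
(i.e. `sΛs⁻¹ ∩ Λ` is small relative to `𝒢` for all `s ∉ Λ`) iff for all `s, t ∈ Γ` with at
least one of `s, t` not in `Λ`, the set `sΛt ∩ Λ` is small relative to `𝒢`. -/
theorem almost_malnormal_rel_iff {Γ : Type*} [Group Γ] {n : ℕ}
    (Sigmas : Fin n → Subgroup Γ) (hnormal : ∀ i, (Sigmas i).Normal) (Λ : Subgroup Γ) :
    (∀ s : Γ, s ∉ Λ →
        SmallRel Sigmas ((fun x => s * x * s⁻¹) '' (Λ : Set Γ) ∩ (Λ : Set Γ))) ↔
      (∀ s t : Γ, s ∉ Λ ∨ t ∉ Λ →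
        SmallRel Sigmas ((fun x => s * x * t) '' (Λ : Set Γ) ∩ (Λ : Set Γ))) := by
  constructor
  · intro h s t hst
    by_cases hne : ((fun x => s * x * t) '' (Λ : Set Γ) ∩ (Λ : Set Γ)).Nonempty
    · obtain ⟨y, ⟨x₀, hx₀, rfl⟩, hy⟩ := hne
      simp only [SetLike.mem_coe] at hx₀ hy
      have hs : s ∉ Λ := by
        intro hs
        rcases hst with h1 | h1
        · exact h1 hs
        · exact h1 ((Λ.mul_mem_cancel_left (Λ.mul_mem hs hx₀)).1 hy)
      obtain ⟨m, a, b, idx, hsub⟩ := h s hs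
      refine ⟨m, a, fun j => b j * (s * x₀ * t), idx, ?_⟩
      rintro _ ⟨⟨x, hx, rfl⟩, hz⟩
      simp only [SetLike.mem_coe] at hx hz
      have key : s * x * t * (s * x₀ * t)⁻¹ ∈
          (fun x => s * x * s⁻¹) '' (Λ : Set Γ) ∩ (Λ : Set Γ) :=
        ⟨⟨x * x₀⁻¹, Λ.mul_mem hx (Λ.inv_mem hx₀), by group⟩,
          Λ.mul_mem hz (Λ.inv_mem hy)⟩
      obtain ⟨j, w, hw, hwe⟩ := Set.mem_iUnion.1 (hsub key)
      refine Set.mem_iUnion.2 ⟨j, w, hw, ?_⟩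
      have hwe' : a j * w * b j = s * x * t * (s * x₀ * t)⁻¹ := hwe
      change a j * w * (b j * (s * x₀ * t)) = s * x * t
      rw [← mul_assoc, hwe', inv_mul_cancel_right]
    · refine ⟨0, Fin.elim0, Fin.elim0, Fin.elim0, ?_⟩
      rw [Set.not_nonempty_iff_eq_empty.1 hne]
      exact Set.empty_subset _
  · intro h s hs
    exact h s s⁻¹ (Or.inl hs)
end
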